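/- Let ν be a shift-invariant tail measure with index α > 0 and spectral tail process Θ. Then Θ satisfies the time change formula: for every h ∈ ℤ and every measurable 0-homogeneous function H_0 : E^ℤ → [0,∞) vanishing on the set {x : ‖x_0‖ = 0}, one has E[H_0(B^h Θ)] = E[‖Θ_h‖^α H_0(Θ)]. -/

import Mathlib

open MeasureTheory
open scoped ENNReal

/-- A measurable cone: a measurable space `E` with a measurable multiplication by positive
scalars, a zero element and a measurable `1`-homogeneous pseudonorm. -/
structure MeasCone (E : Type*) [MeasurableSpace E] where
  smul : ℝ → E → E
  zero : E
  nrm : E → ℝ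
  measurable_smul : Measurable fun p : ℝ × E => smul p.1 p.2
  measurable_nrm : Measurable nrm
  one_smul : ∀ x, smul 1 x = x
  smul_smul : ∀ (u v : ℝ), 0 < u → 0 < v → ∀ x, smul u (smul v x) = smul (u * v) x
  smul_zero' : ∀ (u : ℝ), 0 < u → smul u zero = zero
  nrm_nonneg : ∀ x, 0 ≤ nrm x
  nrm_smul : ∀ (u : ℝ), 0 < u → ∀ x, nrm (smul u x) = u * nrm x
  eq_zero_of_nrm : ∀ x, nrm x = 0 → x = zero

/-- The `k`-th iterate of the backshift operator: `(B^k x)_h = x_{h-k}`. -/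
def seqShift {E : Type*} (k : ℤ) (x : ℤ → E) : ℤ → E := fun h => x (h - k)

/-- Shift invariance of a measure on `E^ℤ`: `ν(BA) = ν(A)` for all measurable `A`. -/
def ShiftInvariant {E : Type*} [MeasurableSpace E] (ν : MeasureTheory.Measure (ℤ → E)) : Prop :=
  ∀ A : Set (ℤ → E), MeasurableSet A → ν (seqShift 1 '' A) = ν A

namespace MeasCone

variable {E : Type*} [MeasurableSpace E] (K : MeasCone E)

/-- The sequence identically equal to the zero element. -/
def zeroSeq : ℤ → E := fun _ => K.zero

/-- Componentwise scalar multiplication on the sequence space `E^ℤ`. -/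
def sSmul (u : ℝ) (x : ℤ → E) : ℤ → E := fun h => K.smul u (x h)


/-- A tail measure with index `α > 0` on `E^ℤ`. -/
def IsTailMeasure (α : ℝ) (ν : Measure (ℤ → E)) : Prop :=
  ν {K.zeroSeq} = 0 ∧
  ν {x | 1 < K.nrm (x 0)} = 1 ∧
  (∀ h : ℤ, ν {x | 1 < K.nrm (x h)} < ⊤) ∧
  ∀ (u : ℝ), 0 < u → ∀ A : Set (ℤ → E), MeasurableSet A →
    ν (K.sSmul u '' A) = ENNReal.ofReal (u ^ (-α)) * ν A

/-- The spectral map at lag `h`: `x ↦ x / ‖x_h‖`. -/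
noncomputable def spectralMap (h : ℤ) (x : ℤ → E) : ℤ → E :=
  fun j => K.smul (K.nrm (x h))⁻¹ (x j)

/-- The law of the local spectral tail process of `ν` at lag `h`:
the pushforward under the spectral map of (the normalization of) the restriction of `ν`
to `{x : ‖x_h‖ > 1}`. -/
noncomputable def spectralLaw (ν : Measure (ℤ → E)) (h : ℤ) : Measure (ℤ → E) :=
  Measure.map (K.spectralMap h)
    ((ν {x | 1 < K.nrm (x h)})⁻¹ • ν.restrict {x | 1 < K.nrm (x h)})

/-- The time change formula for (the law of) a process `Θ`:
`E[H₀(B^h Θ)] = E[‖Θ_h‖^α H₀(Θ)]` for every measurable `0`-homogeneous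
`H₀ : E^ℤ → [0,∞)` vanishing on `{x : ‖x_0‖ = 0}`. -/
def SatisfiesTCF (α : ℝ) (μ : Measure (ℤ → E)) : Prop :=
  ∀ (h : ℤ) (H : (ℤ → E) → ℝ), Measurable H → (∀ x, 0 ≤ H x) →
    (∀ (u : ℝ), 0 < u → ∀ x, H (K.sSmul u x) = H x) →
    (∀ x, K.nrm (x 0) = 0 → H x = 0) →
    ∫⁻ x, ENNReal.ofReal (H (seqShift h x)) ∂μ
      = ∫⁻ x, ENNReal.ofReal (K.nrm (x h) ^ α) * ENNReal.ofReal (H x) ∂μ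

/-- `I(x) = j ∈ ℤ` for the infargmax functional:
`sup_{k ≤ j-1} ‖x_k‖ < ‖x_j‖ = sup_{k ∈ ℤ} ‖x_k‖`. -/
def IsInfArgmax (x : ℤ → E) (j : ℤ) : Prop :=
  (⨆ k : ℤ, ⨆ _ : k < j, ENNReal.ofReal (K.nrm (x k))) < ENNReal.ofReal (K.nrm (x j)) ∧
  ENNReal.ofReal (K.nrm (x j)) = ⨆ k : ℤ, ENNReal.ofReal (K.nrm (x k))

end MeasCone

namespace MeasCone

variable {E : Type*}

lemma seqShift_seqShift (k l : ℤ) (x : ℤ → E) : seqShift k (seqShift l x) = seqShift (k + l) x := by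
  funext h
  simp only [seqShift]
  congr 1
  ring

lemma seqShift_zero (x : ℤ → E) : seqShift 0 x = x := by
  funext h
  simp [seqShift]

variable [MeasurableSpace E]

lemma measurable_seqShift (k : ℤ) : Measurable (seqShift (E := E) k) :=
  measurable_pi_lambda _ fun h => measurable_pi_apply (h - k)

lemma map_seqShift_add (ν : Measure (ℤ → E)) (k l : ℤ) :
    ν.map (seqShift (k + l)) = (ν.map (seqShift l)).map (seqShift k) := by
  rw [Measure.map_map (measurable_seqShift k) (measurable_seqShift l)]
  congr 1
  funext x
  exact (seqShift_seqShift k l x).symm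

lemma map_seqShift_zero (ν : Measure (ℤ → E)) : ν.map (seqShift 0) = ν := by
  have : seqShift (E := E) 0 = id := funext seqShift_zero
  rw [this, Measure.map_id]

/-- A shift-invariant measure is preserved by every power of the backshift. -/
lemma map_seqShift_of_shiftInvariant {ν : Measure (ℤ → E)} (hν : ShiftInvariant ν) (k : ℤ) :
    ν.map (seqShift k) = ν := by
  have hneg : ν.map (seqShift (-1)) = ν := by
    ext A hA
    rw [Measure.map_apply (measurable_seqShift _) hA, ← hν A hA]
    congr 1
    ext x
    constructor
    · intro hx
      exact ⟨_, hx, by rw [seqShift_seqShift, add_neg_cancel, seqShift_zero]⟩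
    · rintro ⟨y, hy, rfl⟩
      rwa [Set.mem_preimage, seqShift_seqShift, neg_add_cancel, seqShift_zero]
  have hone : ν.map (seqShift 1) = ν := by
    conv_lhs => rw [← hneg]
    rw [← map_seqShift_add, add_neg_cancel, map_seqShift_zero]
  induction k using Int.induction_on with
  | zero => exact map_seqShift_zero ν
  | succ i ih => rw [map_seqShift_add, hone, ih]
  | pred i ih => rw [sub_eq_add_neg, map_seqShift_add, hneg, ih]

variable (K : MeasCone E)

lemma measurable_nrm_apply (h : ℤ) : Measurable fun x : ℤ → E => K.nrm (x h) :=
  K.measurable_nrm.comp (measurable_pi_apply h)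

lemma measurable_sSmul (u : ℝ) : Measurable (K.sSmul u) :=
  measurable_pi_lambda _ fun h =>
    K.measurable_smul.comp (measurable_const.prodMk (measurable_pi_apply h))

lemma measurable_spectralMap (h : ℤ) : Measurable (K.spectralMap h) :=
  measurable_pi_lambda _ fun j =>
    K.measurable_smul.comp ((K.measurable_nrm_apply h).inv.prodMk (measurable_pi_apply j))

lemma sSmul_sSmul {u v : ℝ} (hu : 0 < u) (hv : 0 < v) (x : ℤ → E) :
    K.sSmul u (K.sSmul v x) = K.sSmul (u * v) x :=
  funext fun _ => K.smul_smul u v hu hv _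

lemma one_sSmul (x : ℤ → E) : K.sSmul 1 x = x :=
  funext fun _ => K.one_smul _

lemma nrm_sSmul {u : ℝ} (hu : 0 < u) (x : ℤ → E) (h : ℤ) :
    K.nrm (K.sSmul u x h) = u * K.nrm (x h) :=
  K.nrm_smul u hu _

variable {K} {α : ℝ}

lemma IsTailMeasure.map_sSmul {ν : Measure (ℤ → E)} (hν : K.IsTailMeasure α ν) {u : ℝ}
    (hu : 0 < u) : ν.map (K.sSmul u) = ENNReal.ofReal (u ^ α) • ν := by
  have hu' : 0 < u⁻¹ := inv_pos.mpr hu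
  ext A hA
  have hpre : K.sSmul u ⁻¹' A = K.sSmul u⁻¹ '' A := by
    ext x
    constructor
    · intro hx
      exact ⟨_, hx, by rw [K.sSmul_sSmul hu' hu, inv_mul_cancel₀ hu.ne', K.one_sSmul]⟩
    · rintro ⟨y, hy, rfl⟩
      rwa [Set.mem_preimage, K.sSmul_sSmul hu hu', mul_inv_cancel₀ hu.ne', K.one_sSmul]
  rw [Measure.map_apply (K.measurable_sSmul u) hA, hpre, hν.2.2.2 _ hu' A hA,
    Real.inv_rpow hu.le, Real.rpow_neg hu.le, inv_inv, Measure.smul_apply, smul_eq_mul]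

lemma IsTailMeasure.sigmaFinite_restrict {ν : Measure (ℤ → E)} (hν : K.IsTailMeasure α ν) :
    SigmaFinite (ν.restrict {x | 0 < K.nrm (x 0)}) := by
  have hm : ∀ c : ℝ, MeasurableSet {x : ℤ → E | c < K.nrm (x 0)} := fun c =>
    measurableSet_lt measurable_const (K.measurable_nrm_apply 0)
  refine ⟨⟨⟨fun n : ℕ => {x | 0 < K.nrm (x 0)}ᶜ ∪ {x | 1 < (n + 1 : ℝ) * K.nrm (x 0)},
    fun _ => trivial, fun n => ?_, ?_⟩⟩⟩
  · have hn : (0 : ℝ) < n + 1 := by positivity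
    have hle := measure_union_le (μ := ν.restrict {x | 0 < K.nrm (x 0)})
      {x | 0 < K.nrm (x 0)}ᶜ {x | 1 < (n + 1 : ℝ) * K.nrm (x 0)}
    refine hle.trans_lt ?_
    rw [Measure.restrict_apply (hm 0).compl, Set.compl_inter_self, measure_empty, zero_add]
    refine (Measure.restrict_apply_le _ _).trans_lt ?_
    have hmap := congrArg (fun μ => μ {x | 1 < K.nrm (x 0)}) (hν.map_sSmul hn)
    simp only [Measure.map_apply (K.measurable_sSmul _) (hm 1), Measure.smul_apply, hν.2.1,
      Set.preimage_ofPred_eq, K.nrm_sSmul hn, smul_eq_mul, mul_one] at hmap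
    rw [hmap]
    exact ENNReal.ofReal_lt_top
  · refine Set.eq_univ_of_forall fun x => Set.mem_iUnion.mpr ?_
    by_cases hx : 0 < K.nrm (x 0)
    · obtain ⟨n, hn⟩ := exists_nat_gt (K.nrm (x 0))⁻¹
      refine ⟨n, Or.inr ?_⟩
      have h1 : (K.nrm (x 0))⁻¹ * K.nrm (x 0) = 1 := inv_mul_cancel₀ hx.ne'
      show (1 : ℝ) < (n + 1) * K.nrm (x 0)
      nlinarith
    · exact ⟨0, Or.inl hx⟩

lemma IsTailMeasure.map_sSmul_restrict {ν : Measure (ℤ → E)} (hν : K.IsTailMeasure α ν) {u : ℝ}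
    (hu : 0 < u) :
    (ν.restrict {x | 0 < K.nrm (x 0)}).map (K.sSmul u) =
      ENNReal.ofReal (u ^ α) • ν.restrict {x | 0 < K.nrm (x 0)} := by
  have hm : MeasurableSet {x : ℤ → E | 0 < K.nrm (x 0)} :=
    measurableSet_lt measurable_const (K.measurable_nrm_apply 0)
  rw [← Measure.restrict_smul, ← hν.map_sSmul hu, Measure.restrict_map (K.measurable_sSmul u) hm]
  congr 2
  ext x
  simp [K.nrm_sSmul hu, hu]

lemma lintegral_Ioi_inv_sq {c : ℝ} (hc : 0 < c) :
    ∫⁻ t in Set.Ioi c, ENNReal.ofReal (t ^ (-2 : ℝ)) = ENNReal.ofReal c⁻¹ := by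
  rw [← ofReal_integral_eq_lintegral_ofReal (integrableOn_Ioi_rpow_of_lt (by norm_num) hc),
    integral_Ioi_rpow_of_lt (by norm_num) hc]
  · norm_num [Real.rpow_neg_one]
  · filter_upwards [ae_restrict_mem measurableSet_Ioi] with t ht
    exact Real.rpow_nonneg (hc.trans ht).le _

/-- Exchange of the exceedance sets `{‖x_h‖ > 1}` and `{‖x_0‖ > 1}` for a measure that is
homogeneous of index `α`. -/
lemma lintegral_exceedance_swap (hα : 0 < α) {μ : Measure (ℤ → E)} [SFinite μ]
    (hμ : ∀ u : ℝ, 0 < u → μ.map (K.sSmul u) = ENNReal.ofReal (u ^ α) • μ)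
    (hμ0 : ∀ᵐ x ∂μ, 0 < K.nrm (x 0)) (h : ℤ) {G : (ℤ → E) → ℝ≥0∞} (hG : Measurable G)
    (hGhom : ∀ u : ℝ, 0 < u → ∀ x, G (K.sSmul u x) = G x) :
    ∫⁻ x in {x | 1 < K.nrm (x 0)}, ENNReal.ofReal (((K.nrm (x 0))⁻¹ * K.nrm (x h)) ^ α) * G x ∂μ
      = ∫⁻ x in {x | 1 < K.nrm (x h)}, G x ∂μ := by
  have ma := K.measurable_nrm_apply 0
  have mb := K.measurable_nrm_apply h
  have hm : ∀ j : ℤ, MeasurableSet {x : ℤ → E | 1 < K.nrm (x j)} := fun j =>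
    measurableSet_lt measurable_const (K.measurable_nrm_apply j)
  classical
  let f : ℝ → (ℤ → E) → ℝ≥0∞ := fun t x =>
    if 1 < K.nrm (x 0) ∧ t < K.nrm (x h) ^ α then
      ENNReal.ofReal ((K.nrm (x 0) ^ α)⁻¹) * G x else 0
  let g : ℝ → (ℤ → E) → ℝ≥0∞ := fun t x =>
    if (K.nrm (x 0) ^ α)⁻¹ < t ∧ 1 < K.nrm (x h) then
      ENNReal.ofReal (t ^ (-2 : ℝ)) * (ENNReal.ofReal (K.nrm (x 0) ^ α)⁻¹ * G x) else 0
  have mf : Measurable (Function.uncurry f) := by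
    refine Measurable.ite ?_ ?_ measurable_const
    · exact (measurableSet_lt measurable_const (ma.comp measurable_snd)).inter
        (measurableSet_lt measurable_fst ((mb.comp measurable_snd).pow_const α))
    · exact ((((ma.comp measurable_snd).pow_const α).inv).ennreal_ofReal).mul
        (hG.comp measurable_snd)
  have mg : Measurable (Function.uncurry g) := by
    refine Measurable.ite ?_ ?_ measurable_const
    · exact (measurableSet_lt ((ma.comp measurable_snd).pow_const α).inv measurable_fst).inter
        (measurableSet_lt measurable_const (mb.comp measurable_snd))
    · exact (measurable_fst.pow_const _).ennreal_ofReal.mul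
        (((((ma.comp measurable_snd).pow_const α).inv).ennreal_ofReal).mul
          (hG.comp measurable_snd))
  have hfg : ∀ t ∈ Set.Ioi (0 : ℝ), ∫⁻ x, f t x ∂μ = ∫⁻ x, g t x ∂μ := by
    intro t ht
    have ht : 0 < t := ht
    have hr : 0 < t ^ α⁻¹ := Real.rpow_pos_of_pos ht _
    have hrα : (t ^ α⁻¹) ^ α = t := Real.rpow_inv_rpow ht.le hα.ne'
    have mft : Measurable (f t) := mf.comp measurable_prodMk_left
    have hscale := congrArg (fun m => ∫⁻ x, f t x ∂m) (hμ _ hr)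
    simp only [lintegral_map mft (K.measurable_sSmul _), lintegral_smul_measure, hrα,
      smul_eq_mul] at hscale
    have hcancel : ENNReal.ofReal t⁻¹ * ENNReal.ofReal t = 1 := by
      rw [← ENNReal.ofReal_mul (inv_nonneg.mpr ht.le), inv_mul_cancel₀ ht.ne', ENNReal.ofReal_one]
    rw [← one_mul (∫⁻ x, f t x ∂μ), ← hcancel, mul_assoc, ← hscale,
      ← lintegral_const_mul (f := fun x => f t (K.sSmul _ x)) _
        (mft.comp (K.measurable_sSmul _))]
    refine lintegral_congr_ae ?_
    filter_upwards [hμ0] with x hx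
    have hb := K.nrm_nonneg (x h)
    have haα : 0 < K.nrm (x 0) ^ α := Real.rpow_pos_of_pos hx α
    have h1 : 1 < t ^ α⁻¹ * K.nrm (x 0) ↔ (K.nrm (x 0) ^ α)⁻¹ < t := by
      rw [← Real.rpow_lt_rpow_iff zero_le_one (mul_pos hr hx).le hα, Real.one_rpow,
        Real.mul_rpow hr.le hx.le, hrα, inv_lt_iff_one_lt_mul₀ haα]
    have h2 : t < (t ^ α⁻¹ * K.nrm (x h)) ^ α ↔ 1 < K.nrm (x h) := by
      rw [Real.mul_rpow hr.le hb, hrα, lt_mul_iff_one_lt_right ht, Real.one_lt_rpow_iff hb]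
      simp [hα, hα.not_gt]
    have h3 : ENNReal.ofReal t⁻¹ * (ENNReal.ofReal (((t ^ α⁻¹ * K.nrm (x 0)) ^ α)⁻¹) * G x)
        = ENNReal.ofReal (t ^ (-2 : ℝ)) * (ENNReal.ofReal (K.nrm (x 0) ^ α)⁻¹ * G x) := by
      rw [Real.mul_rpow hr.le hx.le, hrα, mul_inv, ENNReal.ofReal_mul (inv_nonneg.mpr ht.le),
        Real.rpow_neg ht.le, Real.rpow_two, sq, mul_inv, ENNReal.ofReal_mul (inv_nonneg.mpr ht.le)]
      ring
    simp only [f, g, K.nrm_sSmul hr, hGhom _ hr, h1, h2, mul_ite, mul_zero, h3]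
  have hf : ∀ x, ∫⁻ t in Set.Ioi 0, f t x = {x : ℤ → E | 1 < K.nrm (x 0)}.indicator
      (fun x => ENNReal.ofReal (((K.nrm (x 0))⁻¹ * K.nrm (x h)) ^ α) * G x) x := by
    intro x
    by_cases hx : 1 < K.nrm (x 0)
    · have ha : 0 ≤ K.nrm (x 0) := K.nrm_nonneg _
      have hb := K.nrm_nonneg (x h)
      have : (fun t => f t x) = (Set.Iio (K.nrm (x h) ^ α)).indicator
          fun _ => ENNReal.ofReal ((K.nrm (x 0) ^ α)⁻¹) * G x := by
        funext t
        simp [f, hx, Set.indicator_apply]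
      rw [this, lintegral_indicator_const measurableSet_Iio,
        Measure.restrict_apply measurableSet_Iio, Set.Iio_inter_Ioi, Real.volume_Ioo, sub_zero,
        Set.indicator_of_mem (by exact hx), Real.mul_rpow (inv_nonneg.mpr ha) hb,
        Real.inv_rpow ha, ENNReal.ofReal_mul (by positivity)]
      ring
    · simp [f, hx]
  have hg : ∀ x, 0 < K.nrm (x 0) → ∫⁻ t in Set.Ioi 0, g t x =
      {x : ℤ → E | 1 < K.nrm (x h)}.indicator G x := by
    intro x hx
    by_cases hxh : 1 < K.nrm (x h)
    · have haα : 0 < K.nrm (x 0) ^ α := Real.rpow_pos_of_pos hx α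
      have hc := inv_pos.mpr haα
      have : (fun t => g t x) = (Set.Ioi (K.nrm (x 0) ^ α)⁻¹).indicator
          fun t => ENNReal.ofReal (t ^ (-2 : ℝ)) *
            (ENNReal.ofReal (K.nrm (x 0) ^ α)⁻¹ * G x) := by
        funext t
        simp [g, hxh, Set.indicator_apply]
      rw [this, lintegral_indicator measurableSet_Ioi, Measure.restrict_restrict measurableSet_Ioi,
        Set.Ioi_inter_Ioi, max_eq_left hc.le,
        lintegral_mul_const _ (f := fun t : ℝ => ENNReal.ofReal (t ^ (-2 : ℝ)))
          (measurable_id.pow_const _).ennreal_ofReal,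
        lintegral_Ioi_inv_sq hc, Set.indicator_of_mem (by exact hxh), ← mul_assoc,
        ← ENNReal.ofReal_mul (inv_nonneg.mpr hc.le), inv_mul_cancel₀ hc.ne', ENNReal.ofReal_one,
        one_mul]
    · simp [g, hxh]
  rw [← lintegral_indicator (hm 0), ← lintegral_indicator (hm h), ← lintegral_congr hf,
    ← lintegral_congr_ae (hμ0.mono hg),
    lintegral_lintegral_swap (f := fun x t => f t x) (mf.comp measurable_swap).aemeasurable,
    lintegral_lintegral_swap (f := fun x t => g t x) (mg.comp measurable_swap).aemeasurable]
  exact setLIntegral_congr_fun measurableSet_Ioi hfg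

end MeasCone

open MeasCone in
/-- the spectral tail process of a shift-invariant tail measure satisfies the
time change formula. -/
theorem spectralTailProcess_satisfiesTCF
    {E : Type*} [MeasurableSpace E] (K : MeasCone E) (α : ℝ) (hα : 0 < α)
    (ν : Measure (ℤ → E)) (hν : K.IsTailMeasure α ν) (hshift : ShiftInvariant ν) :
    K.SatisfiesTCF α (K.spectralLaw ν 0) := by
  intro h H mH _ hhom hvan
  have hm : ∀ j : ℤ, MeasurableSet {x : ℤ → E | 1 < K.nrm (x j)} := fun j =>
    measurableSet_lt measurable_const (K.measurable_nrm_apply j)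
  have hm0 : MeasurableSet {x : ℤ → E | 0 < K.nrm (x 0)} :=
    measurableSet_lt measurable_const (K.measurable_nrm_apply 0)
  have mG : Measurable fun x => ENNReal.ofReal (H x) := mH.ennreal_ofReal
  have hspec : K.spectralLaw ν 0 =
      (ν.restrict {x | 1 < K.nrm (x 0)}).map (K.spectralMap 0) := by
    rw [spectralLaw, hν.2.1, inv_one, _root_.one_smul]
  have hrestrict : ∀ (j : ℤ) (w : (ℤ → E) → ℝ≥0∞),
      ∫⁻ x in {x | 1 < K.nrm (x j)}, w x * ENNReal.ofReal (H x) ∂ν =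
        ∫⁻ x in {x | 1 < K.nrm (x j)}, w x * ENNReal.ofReal (H x)
          ∂ν.restrict {x | 0 < K.nrm (x 0)} := by
    intro j w
    rw [Measure.restrict_restrict (hm j), Set.inter_comm, ← Measure.restrict_restrict hm0]
    refine (setLIntegral_eq_of_support_subset ?_).symm
    intro x hx
    refine (K.nrm_nonneg _).lt_of_ne fun h0 => hx ?_
    simp [hvan x h0.symm]
  have hL : ∫⁻ x, ENNReal.ofReal (H (seqShift h x)) ∂K.spectralLaw ν 0 =
      ∫⁻ x in {x | 1 < K.nrm (x h)}, ENNReal.ofReal (H x) ∂ν := by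
    rw [hspec, lintegral_map (f := fun x => ENNReal.ofReal (H (seqShift h x)))
      (mG.comp (measurable_seqShift h)) (K.measurable_spectralMap 0)]
    conv_rhs => rw [← map_seqShift_of_shiftInvariant hshift h]
    rw [setLIntegral_map (hm h) mG (measurable_seqShift h)]
    have hset : seqShift h ⁻¹' {x : ℤ → E | 1 < K.nrm (x h)} = {x | 1 < K.nrm (x 0)} := by
      ext x
      simp [seqShift]
    rw [hset]
    refine setLIntegral_congr_fun (hm 0) fun x hx => ?_
    have hx : 1 < K.nrm (x 0) := hx
    exact congrArg ENNReal.ofReal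
      (hhom (K.nrm (x 0))⁻¹ (inv_pos.mpr (zero_lt_one.trans hx)) (seqShift h x))
  have hR : ∫⁻ x, ENNReal.ofReal (K.nrm (x h) ^ α) * ENNReal.ofReal (H x) ∂K.spectralLaw ν 0 =
      ∫⁻ x in {x | 1 < K.nrm (x 0)},
        ENNReal.ofReal (((K.nrm (x 0))⁻¹ * K.nrm (x h)) ^ α) * ENNReal.ofReal (H x) ∂ν := by
    rw [hspec, lintegral_map (f := fun x => ENNReal.ofReal (K.nrm (x h) ^ α) * ENNReal.ofReal (H x))
      (((K.measurable_nrm_apply h).pow_const α).ennreal_ofReal.mul mG)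
      (K.measurable_spectralMap 0)]
    refine setLIntegral_congr_fun (hm 0) fun x hx => ?_
    have hpos : 0 < (K.nrm (x 0))⁻¹ := inv_pos.mpr (zero_lt_one.trans hx)
    have hmap : K.spectralMap 0 x = K.sSmul (K.nrm (x 0))⁻¹ x := rfl
    simp only [hmap, K.nrm_sSmul hpos, hhom _ hpos]
  have := hν.sigmaFinite_restrict
  have hswap := lintegral_exceedance_swap hα (fun u hu => hν.map_sSmul_restrict hu)
    (ae_restrict_mem hm0) h mG fun u hu x => by rw [hhom u hu x]
  have hone := hrestrict h fun _ => 1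
  simp only [one_mul] at hone
  rw [hL, hR, hrestrict 0, hone, hswap]
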